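/- Let p ∈ [0,1] and let K₀ = √p·I₂, K₁ = √((1−p)/2)·[[0,1],[0,0]], K₂ = √((1−p)/2)·[[0,0],[0,1]] be the operators of the loss channel as given in the paper. Set ρ' = Σᵢ₌₀² (Kᵢ⊗I₂)·ρ_AB·(Kᵢ⊗I₂)†, the result of applying these operators to the first qubit. Then tr[ρ'·𝔅] = 4√3·p. -/

import Mathlib

open Matrix Kronecker
open scoped ComplexOrder

noncomputable def σx : Matrix (Fin 2) (Fin 2) ℂ := !![0, 1; 1, 0]
noncomputable def σy : Matrix (Fin 2) (Fin 2) ℂ := !![0, -Complex.I; Complex.I, 0]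
noncomputable def σz : Matrix (Fin 2) (Fin 2) ℂ := !![1, 0; 0, -1]

/-- Bob's observables for the Elegant Bell inequality. -/
noncomputable def B1 : Matrix (Fin 2) (Fin 2) ℂ := (Real.sqrt 3 : ℂ)⁻¹ • (σx - σy + σz)
noncomputable def B2 : Matrix (Fin 2) (Fin 2) ℂ := (Real.sqrt 3 : ℂ)⁻¹ • (σx + σy - σz)
noncomputable def B3 : Matrix (Fin 2) (Fin 2) ℂ := (Real.sqrt 3 : ℂ)⁻¹ • (-σx - σy - σz)
noncomputable def B4 : Matrix (Fin 2) (Fin 2) ℂ := (Real.sqrt 3 : ℂ)⁻¹ • (-σx + σy + σz)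

/-- The EBI Bell operator 𝔅 with Alice's observables A₁ = σx, A₂ = σy, A₃ = σz. -/
noncomputable def EBIop : Matrix (Fin 2 × Fin 2) (Fin 2 × Fin 2) ℂ :=
  σx ⊗ₖ (B1 + B2 - B3 - B4) + σy ⊗ₖ (B1 - B2 + B3 - B4) + σz ⊗ₖ (B1 - B2 - B3 + B4)

/-- The maximally entangled two-qubit state. -/
noncomputable def ρAB : Matrix (Fin 2 × Fin 2) (Fin 2 × Fin 2) ℂ :=
  (4 : ℂ)⁻¹ • ((1 : Matrix (Fin 2) (Fin 2) ℂ) ⊗ₖ (1 : Matrix (Fin 2) (Fin 2) ℂ)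
    + σx ⊗ₖ σx - σy ⊗ₖ σy + σz ⊗ₖ σz)

/-- The paper's loss-channel operators with parameter `p`. -/
noncomputable def lossK (p : ℝ) : Fin 3 → Matrix (Fin 2) (Fin 2) ℂ :=
  ![(Real.sqrt p : ℂ) • (1 : Matrix (Fin 2) (Fin 2) ℂ),
    (Real.sqrt ((1 - p) / 2) : ℂ) • !![0, 1; 0, 0],
    (Real.sqrt ((1 - p) / 2) : ℂ) • !![0, 0; 0, 1]]

/-- The EBI operator is a multiple of `σx ⊗ σx - σy ⊗ σy + σz ⊗ σz`. -/
lemma EBIop_eq :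
    EBIop = (4 * (Real.sqrt 3 : ℂ)⁻¹) • (σx ⊗ₖ σx - σy ⊗ₖ σy + σz ⊗ₖ σz) := by
  have h1 : B1 + B2 - B3 - B4 = (4 * (Real.sqrt 3 : ℂ)⁻¹) • σx := by
    unfold B1 B2 B3 B4; module
  have h2 : B1 - B2 + B3 - B4 = -((4 * (Real.sqrt 3 : ℂ)⁻¹) • σy) := by
    unfold B1 B2 B3 B4; module
  have h3 : B1 - B2 - B3 + B4 = (4 * (Real.sqrt 3 : ℂ)⁻¹) • σz := by
    unfold B1 B2 B3 B4; module
  rw [EBIop, h1, h2, h3, ← neg_smul]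
  simp only [kronecker_smul]
  module

/-- Applying the loss-channel operators to the first qubit of the maximally
entangled state gives EBI value `4√3·p`. -/
theorem loss_first_qubit_EBI_value (p : ℝ) (hp0 : 0 ≤ p) (hp1 : p ≤ 1) :
    ((∑ i : Fin 3, (lossK p i ⊗ₖ (1 : Matrix (Fin 2) (Fin 2) ℂ)) * ρAB
        * (lossK p i ⊗ₖ (1 : Matrix (Fin 2) (Fin 2) ℂ))ᴴ) * EBIop).trace
      = ((4 * Real.sqrt 3 * p : ℝ) : ℂ) := by
  have hs : (Real.sqrt p : ℂ) ^ 2 = p := by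
    exact_mod_cast Real.sq_sqrt hp0
  have ht : (Real.sqrt 3 : ℂ) ^ 2 = 3 := by
    exact_mod_cast Real.sq_sqrt (by norm_num : (0 : ℝ) ≤ 3)
  have ht0 : (Real.sqrt 3 : ℂ) ≠ 0 := by
    intro h
    norm_num [h] at ht
  rw [EBIop_eq, Matrix.mul_smul, trace_smul, Fin.sum_univ_three]
  simp only [lossK, cons_val_zero, cons_val_one, cons_val, smul_kronecker, conjTranspose_smul,
    Matrix.smul_mul, Matrix.mul_smul, smul_smul, RCLike.star_def, Complex.conj_ofReal, ← sq, hs,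
    Matrix.add_mul, trace_add, trace_smul]
  generalize (Real.sqrt ((1 - p) / 2) : ℂ) = r
  simp [ρAB, σx, σy, σz, Matrix.trace, Fintype.sum_prod_type, Matrix.mul_apply, Fin.sum_univ_two,
    kroneckerMap_apply, Matrix.one_apply]
  field_simp
  linear_combination (-4 * (p : ℂ)) * ht
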